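/- arXiv:1301.6979 — 2 statements merged into one kernel-verified Lean document; each statement's English description precedes it below -/
import Mathlib

section
/- Let n ≥ 2 and let T = (T_{ijk}), 1 ≤ i,j ≤ n, k ∈ {1,2}, be a 3-tensor of independent indeterminates over an infinite field K, with X = (T_{ij1}), Y = (T_{ij2}). Then the ring of invariants K[T]^{SL(n,K)×SL(n,K)} under the action (P,Q)·X = PᵀXQ, (P,Q)·Y = PᵀYQ equals K[f_{n,0}, f_{n-1,1}, ..., f_{0,n}], and is a polynomial ring in n+1 variables over K. -/
open MvPolynomial

/-- The K-algebra endomorphism of K[T] induced by (P,Q): X ↦ PᵀXQ, Y ↦ PᵀYQ,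
i.e. the variable T_{ijk} is sent to Σ_{a,b} P_{ai} Q_{bj} T_{abk}. -/
noncomputable def slPairAction (K : Type*) [CommSemiring K] (n : ℕ)
    (P Q : Matrix (Fin n) (Fin n) K) :
    MvPolynomial (Fin n × Fin n × Fin 2) K →ₐ[K] MvPolynomial (Fin n × Fin n × Fin 2) K :=
  MvPolynomial.aeval fun v =>
    ∑ a : Fin n, ∑ b : Fin n,
      MvPolynomial.C (P a v.1 * Q b v.2.1) * MvPolynomial.X (a, b, v.2.2)

/-- The bihomogeneous component f_{k,n-k} of det(X+Y), X = (T_{ij0}), Y = (T_{ij1}). -/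
noncomputable def fPoly (K : Type*) [CommRing K] (n k : ℕ) :
    MvPolynomial (Fin n × Fin n × Fin 2) K :=
  ∑ S ∈ Finset.powersetCard k (Finset.univ : Finset (Fin n)),
    (Matrix.of fun i j =>
        if j ∈ S then
          (MvPolynomial.X (i, j, (0 : Fin 2)) : MvPolynomial (Fin n × Fin n × Fin 2) K)
        else MvPolynomial.X (i, j, (1 : Fin 2))).det

/-- The sum of the determinants of all matrices made of `k` columns of `A` and the complementary
columns of `B`. -/
def mixedDet {R : Type*} [CommRing R] {n : ℕ} (k : ℕ) (A B : Matrix (Fin n) (Fin n) R) : R :=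
  ∑ S ∈ Finset.powersetCard k (Finset.univ : Finset (Fin n)),
    (Matrix.of fun i j => if j ∈ S then A i j else B i j).det

section MixedDet

variable {R : Type*} [CommRing R] {n : ℕ}

theorem Matrix.det_add_eq_sum_mixed (A B : Matrix (Fin n) (Fin n) R) :
    (A + B).det =
      ∑ S : Finset (Fin n), (Matrix.of fun i j => if j ∈ S then A i j else B i j).det := by
  rw [← Matrix.det_transpose, Matrix.transpose_add]
  have h := (Matrix.detRowAlternating (R := R) (n := Fin n)).toMultilinearMap.map_add_univ
    A.transpose B.transpose
  refine h.trans (Finset.sum_congr rfl fun S _ => ?_)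
  rw [← Matrix.det_transpose]
  change Matrix.det _ = _
  congr 1
  ext i j
  by_cases hi : i ∈ S <;> simp [Finset.piecewise, hi]

theorem map_mixedDet {S : Type*} [CommRing S] (φ : R →+* S) (k : ℕ)
    (A B : Matrix (Fin n) (Fin n) R) :
    φ (mixedDet k A B) = mixedDet k (A.map φ) (B.map φ) := by
  simp only [mixedDet, map_sum, RingHom.map_det]
  refine Finset.sum_congr rfl fun S _ => congrArg Matrix.det ?_
  ext i j
  by_cases hj : j ∈ S <;> simp [hj]

theorem mixedDet_eq_coeff (k : ℕ) (A B : Matrix (Fin n) (Fin n) R) :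
    mixedDet k A B =
      ((Polynomial.X : Polynomial R) • A.map Polynomial.C + B.map Polynomial.C).det.coeff k := by
  rw [Matrix.det_add_eq_sum_mixed, Polynomial.finsetSum_coeff, mixedDet,
    ← Finset.univ_filter_card_eq, Finset.sum_filter]
  refine Finset.sum_congr rfl fun S _ => ?_
  have h : (Matrix.of fun i j => if j ∈ S then
        ((Polynomial.X : Polynomial R) • A.map Polynomial.C) i j else B.map Polynomial.C i j).det =
      Polynomial.C (Matrix.of fun i j => if j ∈ S then A i j else B i j).det *
        Polynomial.X ^ S.card := by
    have h1 := Matrix.det_mul_row (fun j => if j ∈ S then (Polynomial.X : Polynomial R) else 1)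
      ((Matrix.of fun i j => if j ∈ S then A i j else B i j).map Polynomial.C)
    rw [Finset.prod_ite_mem, Finset.univ_inter, Finset.prod_const, ← RingHom.mapMatrix_apply,
      ← RingHom.map_det, mul_comm] at h1
    rw [← h1]
    congr 1
    ext i j : 2
    by_cases hj : j ∈ S <;> simp [hj]
  rw [h, Polynomial.coeff_C_mul_X_pow]
  simp only [eq_comm]

theorem mixedDet_symm {k : ℕ} (hk : k ≤ n) (A B : Matrix (Fin n) (Fin n) R) :
    mixedDet k A B = mixedDet (n - k) B A := by
  unfold mixedDet
  refine Finset.sum_bij' (fun S _ => Sᶜ) (fun S _ => Sᶜ) ?_ ?_ (by simp) (by simp) ?_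
  · intro S hS
    simp only [Finset.mem_powersetCard_univ] at hS ⊢
    rw [Finset.card_compl, hS, Fintype.card_fin]
  · intro S hS
    simp only [Finset.mem_powersetCard_univ] at hS ⊢
    rw [Finset.card_compl, hS, Fintype.card_fin]
    omega
  · intro S _
    congr 1
    ext i j
    by_cases hj : j ∈ S <;> simp [hj]

theorem mixedDet_mul_mul (k : ℕ) (P Q A B : Matrix (Fin n) (Fin n) R)
    (hP : P.det = 1) (hQ : Q.det = 1) :
    mixedDet k (P * A * Q) (P * B * Q) = mixedDet k A B := by
  have hdet (P : Matrix (Fin n) (Fin n) R) (hP : P.det = 1) :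
      (P.map (Polynomial.C : R →+* Polynomial R)).det = 1 := by
    rw [← RingHom.mapMatrix_apply, ← RingHom.map_det, hP, map_one]
  rw [mixedDet_eq_coeff, mixedDet_eq_coeff]
  have h : (Polynomial.X : Polynomial R) • (P * A * Q).map Polynomial.C +
      (P * B * Q).map Polynomial.C = P.map Polynomial.C *
        ((Polynomial.X : Polynomial R) • A.map Polynomial.C + B.map Polynomial.C) *
          Q.map Polynomial.C := by
    simp only [Matrix.map_mul, Matrix.mul_add, Matrix.add_mul, Matrix.mul_smul, Matrix.smul_mul]
  rw [h, Matrix.det_mul, Matrix.det_mul, hdet P hP, hdet Q hQ, one_mul, mul_one]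

theorem mixedDet_self (A B : Matrix (Fin n) (Fin n) R) : mixedDet n A B = A.det := by
  have h : Finset.powersetCard n (Finset.univ : Finset (Fin n)) = {Finset.univ} := by
    simpa using Finset.powersetCard_self (Finset.univ : Finset (Fin n))
  rw [mixedDet, h, Finset.sum_singleton]
  congr 1
  ext i j
  simp

/-- `det (s A + B)` for `A = D`, `B = - C D` is `det D` times the characteristic polynomial
of `C`. -/
theorem mixedDet_neg_mul (k : ℕ) (C D : Matrix (Fin n) (Fin n) R) :
    mixedDet k D (-(C * D)) = C.charpoly.coeff k * D.det := by
  have h : (Polynomial.X : Polynomial R) • D.map Polynomial.C +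
      (-(C * D)).map Polynomial.C = C.charmatrix * D.map Polynomial.C := by
    rw [Matrix.charmatrix, Matrix.sub_mul, Matrix.scalar_apply, ← Matrix.smul_one_eq_diagonal,
      Matrix.smul_mul, Matrix.one_mul, sub_eq_add_neg]
    congr 1
    rw [RingHom.mapMatrix_apply, ← Matrix.map_mul]
    ext i j : 2
    simp only [Matrix.neg_apply, Matrix.map_apply, map_neg]
  rw [mixedDet_eq_coeff, h, Matrix.det_mul, ← RingHom.mapMatrix_apply, ← RingHom.map_det,
    Polynomial.coeff_mul_C, Matrix.charpoly]

end MixedDet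

section Evaluation

/-- The point of affine space whose coordinates are the entries of the pair of matrices `(A, B)`. -/
def pairPoint {R : Type*} {n : ℕ} (A B : Matrix (Fin n) (Fin n) R) : Fin n × Fin n × Fin 2 → R :=
  fun v => if v.2.2 = 0 then A v.1 v.2.1 else B v.1 v.2.1

theorem exists_eq_pairPoint {R : Type*} {n : ℕ} (x : Fin n × Fin n × Fin 2 → R) :
    ∃ A B : Matrix (Fin n) (Fin n) R, x = pairPoint A B := by
  refine ⟨Matrix.of fun i j => x (i, j, 0), Matrix.of fun i j => x (i, j, 1), ?_⟩
  ext ⟨i, j, k⟩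
  fin_cases k <;> simp [pairPoint]

theorem map_pairPoint {R S : Type*} {n : ℕ} (φ : R → S) (A B : Matrix (Fin n) (Fin n) R)
    (v : Fin n × Fin n × Fin 2) : φ (pairPoint A B v) = pairPoint (A.map φ) (B.map φ) v := by
  unfold pairPoint
  split_ifs <;> rfl

variable {K : Type*} [Field K] {n : ℕ}

theorem fPoly_eq_mixedDet (k : ℕ) :
    fPoly K n k = mixedDet k
      (Matrix.of fun i j => (X (i, j, 0) : MvPolynomial (Fin n × Fin n × Fin 2) K))
      (Matrix.of fun i j => X (i, j, 1)) :=
  rfl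

theorem eval_fPoly (k : ℕ) (A B : Matrix (Fin n) (Fin n) K) :
    eval (pairPoint A B) (fPoly K n k) = mixedDet k A B := by
  rw [fPoly_eq_mixedDet, map_mixedDet]
  congr 1 <;> ext i j <;> simp [pairPoint]

theorem eval_aeval_fPoly {ι : Type*} (e : ι → ℕ) (A B : Matrix (Fin n) (Fin n) K)
    (p : MvPolynomial ι K) : eval (pairPoint A B) (aeval (fun k => fPoly K n (e k)) p) =
      eval (fun k => mixedDet (e k) A B) p := by
  induction p using MvPolynomial.induction_on with
  | C a => simp
  | add p q hp hq => simp only [map_add, hp, hq]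
  | mul_X p k hp => rw [map_mul, map_mul, hp, aeval_X, map_mul, eval_X, eval_fPoly]

theorem eval_slPairAction (P Q A B : Matrix (Fin n) (Fin n) K)
    (f : MvPolynomial (Fin n × Fin n × Fin 2) K) :
    eval (pairPoint A B) (slPairAction K n P Q f) =
      eval (pairPoint (P.transpose * A * Q) (P.transpose * B * Q)) f := by
  have h (x : Fin n × Fin n × Fin 2 → K) (p : MvPolynomial (Fin n × Fin n × Fin 2) K) :
      eval x p = aeval x p := by rw [aeval_eq_eval]
  rw [h, h, ← AlgHom.comp_apply]
  congr 1
  refine algHom_ext fun v => ?_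
  obtain ⟨i, j, k⟩ := v
  rw [AlgHom.comp_apply, slPairAction, aeval_X, aeval_X, ← h]
  simp only [map_sum, map_mul, eval_C, eval_X]
  by_cases hk : k = 0 <;>
  · simp only [pairPoint, hk, if_true, if_false, Matrix.mul_apply, Matrix.transpose_apply,
      Finset.sum_mul]
    rw [Finset.sum_comm]
    refine Finset.sum_congr rfl fun b _ => Finset.sum_congr rfl fun a _ => ?_
    ring

theorem slPairAction_fPoly [Infinite K] (k : ℕ) (P Q : Matrix (Fin n) (Fin n) K)
    (hP : P.det = 1) (hQ : Q.det = 1) : slPairAction K n P Q (fPoly K n k) = fPoly K n k := by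
  refine MvPolynomial.funext fun x => ?_
  obtain ⟨A, B, rfl⟩ := exists_eq_pairPoint x
  rw [eval_slPairAction, eval_fPoly, eval_fPoly,
    mixedDet_mul_mul k _ _ _ _ (by rwa [Matrix.det_transpose]) hQ]

theorem exists_charpoly_eq {p : Polynomial K} (hp : p.Monic) (hn : p.natDegree = n) :
    ∃ C : Matrix (Fin n) (Fin n) K, C.charpoly = p := by
  have h (b : PowerBasis K (AdjoinRoot p)) (hb : b.dim = n) (hgen : minpoly K b.gen = p) :
      ∃ C : Matrix (Fin n) (Fin n) K, C.charpoly = p := by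
    subst hb
    exact ⟨Algebra.leftMulMatrix b.basis b.gen, by rw [charpoly_leftMulMatrix, hgen]⟩
  exact h (AdjoinRoot.powerBasis hp.ne_zero) (by rw [AdjoinRoot.powerBasis_dim, hn])
    (AdjoinRoot.minpoly_powerBasis_gen_of_monic hp)

/-- The diagonal matrix `diag(y, 1, …, 1)`. -/
def diagFirst {R : Type*} [CommRing R] {m : ℕ} (y : R) : Matrix (Fin (m + 1)) (Fin (m + 1)) R :=
  Matrix.diagonal fun i => if i = 0 then y else 1

theorem det_diagFirst {m : ℕ} (y : K) : (diagFirst y : Matrix (Fin (m + 1)) _ K).det = y := by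
  simp [diagFirst, Matrix.det_diagonal]

theorem exists_mixedDet_eq {m : ℕ} (z : Fin (m + 2) → K) (hz : z (Fin.last (m + 1)) ≠ 0) :
    ∃ A B : Matrix (Fin (m + 1)) (Fin (m + 1)) K, ∀ k : Fin (m + 2), mixedDet k A B = z k := by
  set q : Polynomial K := ∑ i : Fin (m + 1),
    Polynomial.C (z i.castSucc / z (Fin.last (m + 1))) * Polynomial.X ^ (i : ℕ) with hq
  have hdeg : q.degree < ((m + 1 : ℕ) : WithBot ℕ) := Polynomial.degree_sum_fin_lt _
  obtain ⟨C, hC⟩ := exists_charpoly_eq (n := m + 1) (Polynomial.monic_X_pow_add hdeg)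
    (by rw [Polynomial.natDegree_add_eq_left_of_degree_lt (by rwa [Polynomial.degree_X_pow]),
      Polynomial.natDegree_X_pow])
  refine ⟨diagFirst (z (Fin.last _)), -(C * diagFirst (z (Fin.last _))), fun k => ?_⟩
  rw [mixedDet_neg_mul, hC, det_diagFirst, Polynomial.coeff_add]
  induction k using Fin.lastCases with
  | last =>
    rw [Fin.val_last, Polynomial.coeff_eq_zero_of_degree_lt hdeg]
    simp
  | cast i =>
    have hi : (i : ℕ) ≠ m + 1 := i.2.ne
    have h : q.coeff (i : ℕ) = z i.castSucc / z (Fin.last (m + 1)) := by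
      rw [hq, Polynomial.finsetSum_coeff, Finset.sum_eq_single i]
      · simp
      · intro b _ hb
        rw [Polynomial.coeff_C_mul_X_pow, if_neg fun h => hb (Fin.ext h.symm)]
      · simp
    rw [Fin.val_castSucc, h, Polynomial.coeff_X_pow, if_neg hi, zero_add, div_mul_cancel₀ _ hz]

theorem exists_mixedDet_eq' {m : ℕ} (z : Fin (m + 2) → K) (hz : z 0 ≠ 0) :
    ∃ A B : Matrix (Fin (m + 1)) (Fin (m + 1)) K, ∀ k : Fin (m + 2), mixedDet k A B = z k := by
  obtain ⟨A, B, h⟩ := exists_mixedDet_eq (fun k => z k.rev) (by simpa using hz)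
  refine ⟨B, A, fun k => ?_⟩
  rw [mixedDet_symm (Nat.lt_succ_iff.mp k.2)]
  have := h k.rev
  rw [Fin.rev_rev, Fin.val_rev] at this
  rw [← this]
  congr 1
  omega

end Evaluation

section Polynomials

variable {K : Type*} [Field K]

/-- Clearing denominators when fractions with a common denominator `h` are substituted in a
polynomial. -/
theorem exists_clear_denominators {σ τ : Type*} (g : σ → MvPolynomial τ K) (h : MvPolynomial τ K)
    (f : MvPolynomial σ K) :
    ∃ (N : ℕ) (p : MvPolynomial τ K), ∀ z : τ → K, eval z h ≠ 0 →
      eval z p = eval z h ^ N * eval (fun v => eval z (g v) / eval z h) f := by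
  induction f using MvPolynomial.induction_on with
  | C a => exact ⟨0, C a, fun z _ => by simp⟩
  | add f₁ f₂ h₁ h₂ =>
    obtain ⟨N₁, p₁, h₁⟩ := h₁
    obtain ⟨N₂, p₂, h₂⟩ := h₂
    refine ⟨N₁ + N₂, h ^ N₂ * p₁ + h ^ N₁ * p₂, fun z hz => ?_⟩
    simp only [map_add, map_mul, map_pow, h₁ z hz, h₂ z hz]
    ring
  | mul_X f i hf =>
    obtain ⟨N, p, hp⟩ := hf
    refine ⟨N + 1, p * g i, fun z hz => ?_⟩
    simp only [map_mul, hp z hz, eval_X]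
    field_simp
    ring

theorem X_dvd_sub_aeval_update {τ : Type*} [DecidableEq τ] (i : τ) (p : MvPolynomial τ K) :
    (X i : MvPolynomial τ K) ∣ p - aeval (Function.update X i 0) p := by
  induction p using MvPolynomial.induction_on with
  | C a => simp
  | add p q hp hq =>
    rw [map_add, add_sub_add_comm]
    exact dvd_add hp hq
  | mul_X p j hp =>
    rw [map_mul, aeval_X]
    by_cases hj : j = i
    · subst hj
      simp
    · rw [Function.update_of_ne hj, ← sub_mul]
      exact dvd_mul_of_dvd_left hp _

/-- A polynomial vanishing at the points of the hyperplane `z i = 0` with `z j ≠ 0` is divisible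
by `X i`. -/
theorem X_dvd_of_eval_eq_zero [Infinite K] {τ : Type*} {i j : τ} (hij : j ≠ i)
    (p : MvPolynomial τ K) (hp : ∀ z : τ → K, z i = 0 → z j ≠ 0 → eval z p = 0) :
    (X i : MvPolynomial τ K) ∣ p := by
  classical
  have h0 : aeval (Function.update X i (0 : MvPolynomial τ K)) p * X j = 0 := by
    refine MvPolynomial.funext fun z => ?_
    have h (q : MvPolynomial τ K) : eval z (aeval (Function.update X i (0 : MvPolynomial τ K)) q) =
        eval (Function.update z i 0) q := by
      induction q using MvPolynomial.induction_on with
      | C a => simp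
      | add p q hp hq => simp only [map_add, hp, hq]
      | mul_X p l hp =>
        rw [map_mul, map_mul, hp, aeval_X, map_mul, eval_X]
        by_cases hl : l = i
        · subst hl
          simp
        · simp [Function.update_of_ne hl]
    rw [map_mul, h, map_zero, eval_X]
    by_cases hz : z j = 0
    · rw [hz, mul_zero]
    · rw [hp _ (Function.update_self ..) (by rwa [Function.update_of_ne hij]), zero_mul]
  have h := X_dvd_sub_aeval_update i p
  rwa [(mul_eq_zero.mp h0).resolve_right (X_ne_zero j), sub_zero] at h

end Polynomials

section NormalForm

/-- The matrix whose last column is `-c`, with `a` on the subdiagonal and zeros elsewhere. For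
`a = 1` it is the companion matrix of the monic polynomial with coefficients `c`. -/
def companionLike {R : Type*} [CommRing R] {m : ℕ} (a : R) (c : Fin (m + 1) → R) :
    Matrix (Fin (m + 1)) (Fin (m + 1)) R :=
  Matrix.of fun i j => if j = Fin.last m then -c i else if (i : ℕ) = j + 1 then a else 0

/-- The matrix with columns `e₀, M e₀, M² e₀, …`. -/
def krylovMatrix {R : Type*} [CommRing R] {m : ℕ} (M : Matrix (Fin (m + 1)) (Fin (m + 1)) R) :
    Matrix (Fin (m + 1)) (Fin (m + 1)) R :=
  Matrix.of fun i j => (M ^ (j : ℕ)) i 0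

theorem mul_krylovMatrix {R : Type*} [CommRing R] [Nontrivial R] {m : ℕ}
    (M : Matrix (Fin (m + 1)) (Fin (m + 1)) R) :
    M * krylovMatrix M =
      krylovMatrix M * companionLike 1 (fun i : Fin (m + 1) => M.charpoly.coeff i) := by
  ext i j
  have hl : (M * krylovMatrix M) i j = (M ^ ((j : ℕ) + 1)) i 0 := by
    rw [pow_succ']
    simp [Matrix.mul_apply, krylovMatrix]
  rw [hl]
  induction j using Fin.lastCases with
  | last =>
    have h := Matrix.aeval_self_charpoly M
    rw [M.charpoly_monic.as_sum, M.charpoly_natDegree_eq_dim, Fintype.card_fin] at h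
    simp only [map_add, map_pow, map_sum, map_mul, Polynomial.aeval_X, Polynomial.aeval_C] at h
    rw [Fin.val_last, eq_neg_of_add_eq_zero_left h, ← Fin.sum_univ_eq_sum_range
      (fun k => algebraMap R (Matrix (Fin (m + 1)) (Fin (m + 1)) R) (M.charpoly.coeff k) * M ^ k)]
    simp only [← Algebra.smul_def, Matrix.neg_apply, Matrix.sum_apply, Matrix.smul_apply,
      Matrix.mul_apply, krylovMatrix, companionLike, Matrix.of_apply, if_true, smul_eq_mul,
      mul_neg, Finset.sum_neg_distrib, mul_comm]
  | cast j =>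
    rw [Matrix.mul_apply, Finset.sum_eq_single j.succ]
    · simp [krylovMatrix, companionLike, Fin.castSucc_ne_last]
    · intro b _ hb
      have : (b : ℕ) ≠ j + 1 := fun h => hb (Fin.ext (by simpa using h))
      simp [companionLike, Fin.castSucc_ne_last, this]
    · simp

theorem krylovMatrix_companionLike_zero {R : Type*} [CommRing R] {m : ℕ} :
    krylovMatrix (companionLike (1 : R) (0 : Fin (m + 1) → R)) = 1 := by
  have h (j : ℕ) (hj : j ≤ m) (i : Fin (m + 1)) :
      (companionLike (1 : R) (0 : Fin (m + 1) → R) ^ j) i 0 = if (i : ℕ) = j then 1 else 0 := by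
    induction j generalizing i with
    | zero => simp only [pow_zero, Matrix.one_apply, Fin.ext_iff, Fin.val_zero]
    | succ j ih =>
      rw [pow_succ', Matrix.mul_apply, Finset.sum_eq_single ⟨j, by omega⟩]
      · rw [ih (by omega)]
        have : (⟨j, by omega⟩ : Fin (m + 1)) ≠ Fin.last m := by
          simp [Fin.ext_iff]
          omega
        simp [companionLike, this]
      · intro b _ hb
        rw [ih (by omega), if_neg fun h => hb (Fin.ext h), mul_zero]
      · simp
  ext i j
  rw [krylovMatrix, Matrix.of_apply, h j (by omega), Matrix.one_apply]
  simp [Fin.ext_iff]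

theorem krylovMatrix_smul {R : Type*} [CommRing R] {m : ℕ} (a : R)
    (M : Matrix (Fin (m + 1)) (Fin (m + 1)) R) :
    krylovMatrix (a • M) = krylovMatrix M * Matrix.diagonal fun j : Fin (m + 1) => a ^ (j : ℕ) := by
  ext i j
  rw [Matrix.mul_diagonal]
  simp [krylovMatrix, smul_pow, mul_comm]

theorem map_krylovMatrix {R S : Type*} [CommRing R] [CommRing S] {m : ℕ} (φ : R →+* S)
    (M : Matrix (Fin (m + 1)) (Fin (m + 1)) R) :
    (krylovMatrix M).map φ = krylovMatrix (M.map φ) := by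
  ext i j
  simp only [krylovMatrix, Matrix.map_apply, Matrix.of_apply]
  rw [← RingHom.mapMatrix_apply, ← map_pow]
  rfl

theorem map_diagFirst {R S : Type*} [CommRing R] [CommRing S] {m : ℕ} (φ : R →+* S) (y : R) :
    (diagFirst y : Matrix (Fin (m + 1)) (Fin (m + 1)) R).map φ = diagFirst (φ y) := by
  rw [diagFirst, Matrix.diagonal_map (map_zero φ), diagFirst]
  congr 1
  ext i
  split_ifs <;> simp

theorem map_companionLike {R S : Type*} [CommRing R] [CommRing S] {m : ℕ} (φ : R →+* S) (a : R)
    (c : Fin (m + 1) → R) :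
    (companionLike a c).map φ = companionLike (φ a) (fun i => φ (c i)) := by
  ext i j
  simp only [companionLike, Matrix.map_apply, Matrix.of_apply]
  split_ifs <;> simp

variable {K : Type*} [Field K] [Infinite K] {m : ℕ}
  {f : MvPolynomial (Fin (m + 1) × Fin (m + 1) × Fin 2) K}

/-- An invariant takes the same value on `(D A, D B)` and `(A D, B D)` for every `D` of the form
`diag(s, 1, …, 1)`. -/
theorem eval_diagFirst_mul_eq
    (hf : ∀ P Q A B : Matrix (Fin (m + 1)) (Fin (m + 1)) K, P.det = 1 → Q.det = 1 →
      eval (pairPoint (P * A * Q) (P * B * Q)) f = eval (pairPoint A B) f)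
    (s : K) (A B : Matrix (Fin (m + 1)) (Fin (m + 1)) K) :
    eval (pairPoint (diagFirst s * A) (diagFirst s * B)) f =
      eval (pairPoint (A * diagFirst s) (B * diagFirst s)) f := by
  let φ (s : K) : Polynomial K →+* K := Polynomial.evalRingHom s
  let D : Matrix (Fin (m + 1)) (Fin (m + 1)) (Polynomial K) := diagFirst Polynomial.X
  let A' := A.map (Polynomial.C : K →+* Polynomial K)
  let B' := B.map (Polynomial.C : K →+* Polynomial K)
  let u : Polynomial K :=
    aeval (pairPoint (D * A') (D * B')) f - aeval (pairPoint (A' * D) (B' * D)) f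
  have hD (s : K) : D.map (φ s) = diagFirst s := by
    rw [map_diagFirst]
    simp [φ]
  have hC (s : K) (M : Matrix (Fin (m + 1)) (Fin (m + 1)) K) :
      (M.map (Polynomial.C : K →+* Polynomial K)).map (φ s) = M := by
    ext i j
    simp [φ]
  have haeval (s : K) (M N : Matrix (Fin (m + 1)) (Fin (m + 1)) (Polynomial K)) :
      φ s (aeval (pairPoint M N) f) = eval (pairPoint (M.map (φ s)) (N.map (φ s))) f := by
    have h1 : (φ s).comp (algebraMap K (Polynomial K)) = RingHom.id K := by
      ext
      simp [φ]
    rw [aeval_def, hom_eval₂, h1, eval, coe_eval₂Hom]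
    congr 1
    funext v
    exact map_pairPoint (φ s) M N v
  have hu (s : K) : u.eval s = eval (pairPoint (diagFirst s * A) (diagFirst s * B)) f -
      eval (pairPoint (A * diagFirst s) (B * diagFirst s)) f := by
    change φ s u = _
    simp only [u, A', B', map_sub, haeval, Matrix.map_mul, hD, hC]
  have hroot (t : K) (ht : t ≠ 0) : u.eval (t ^ (m + 1)) = 0 := by
    set P : Matrix (Fin (m + 1)) (Fin (m + 1)) K := t⁻¹ • diagFirst (t ^ (m + 1)) with hP
    have hdet : P.det = 1 := by
      rw [hP, Matrix.det_smul, det_diagFirst, Fintype.card_fin, ← mul_pow, inv_mul_cancel₀ ht,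
        one_pow]
    have hl (M : Matrix (Fin (m + 1)) (Fin (m + 1)) K) :
        diagFirst (t ^ (m + 1)) * M = P * (t • M) * 1 := by
      rw [hP, Matrix.mul_one, Matrix.smul_mul, Matrix.mul_smul, smul_smul, inv_mul_cancel₀ ht,
        one_smul]
    have hr (M : Matrix (Fin (m + 1)) (Fin (m + 1)) K) :
        M * diagFirst (t ^ (m + 1)) = 1 * (t • M) * P := by
      rw [hP, Matrix.one_mul, Matrix.smul_mul, Matrix.mul_smul, smul_smul, mul_inv_cancel₀ ht,
        one_smul]
    rw [hu, hl, hl, hr, hr, hf _ _ _ _ hdet Matrix.det_one, hf _ _ _ _ Matrix.det_one hdet,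
      sub_self]
  have hu0 : u = 0 := by
    rw [← Polynomial.expand_eq_zero m.succ_pos]
    refine Polynomial.eq_zero_of_infinite_isRoot _
      ((Set.finite_singleton (0 : K)).infinite_compl.mono fun t ht => ?_)
    rw [Set.mem_ofPred_eq, Polynomial.IsRoot, Polynomial.expand_eval]
    exact hroot t ht
  have := hu s
  rw [hu0, Polynomial.eval_zero] at this
  exact (sub_eq_zero.mp this.symm)

theorem eval_eq_eval_normalForm
    (hf : ∀ P Q A B : Matrix (Fin (m + 1)) (Fin (m + 1)) K, P.det = 1 → Q.det = 1 →
      eval (pairPoint (P * A * Q) (P * B * Q)) f = eval (pairPoint A B) f)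
    (A M : Matrix (Fin (m + 1)) (Fin (m + 1)) K) (hA : A.det ≠ 0)
    (hM : (krylovMatrix M).det ≠ 0) :
    eval (pairPoint A (-(M * A))) f = eval (pairPoint (diagFirst A.det)
      (-(companionLike 1 (fun i : Fin (m + 1) => M.charpoly.coeff i) * diagFirst A.det))) f := by
  have hmul := mul_krylovMatrix M
  set S := krylovMatrix M
  set C := companionLike 1 (fun i : Fin (m + 1) => M.charpoly.coeff i)
  have hSu : IsUnit S.det := hM.isUnit
  have hSM : S⁻¹ * M = C * S⁻¹ := by
    rw [← Matrix.mul_one (S⁻¹ * M), ← Matrix.mul_nonsing_inv S hSu, ← Matrix.mul_assoc,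
      Matrix.mul_assoc S⁻¹, hmul, ← Matrix.mul_assoc S⁻¹, Matrix.nonsing_inv_mul S hSu,
      Matrix.one_mul]
  have hSinv : S⁻¹.det = S.det⁻¹ := by
    rw [Matrix.det_nonsing_inv, Ring.inverse_eq_inv']
  set R := S⁻¹ * A with hR
  have hP : (diagFirst S.det * S⁻¹).det = 1 := by
    rw [Matrix.det_mul, det_diagFirst, hSinv, mul_inv_cancel₀ hM]
  set W := R * diagFirst S.det with hW
  have hWdet : W.det = A.det := by
    rw [hW, Matrix.det_mul, hR, Matrix.det_mul, det_diagFirst, hSinv, mul_right_comm,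
      inv_mul_cancel₀ hM, one_mul]
  have hWu : IsUnit W.det := by
    rw [hWdet]
    exact hA.isUnit
  have hQ : (W⁻¹ * diagFirst A.det).det = 1 := by
    rw [Matrix.det_mul, det_diagFirst, Matrix.det_nonsing_inv, Ring.inverse_eq_inv', hWdet,
      inv_mul_cancel₀ hA]
  rw [← hf _ 1 A _ hP Matrix.det_one, Matrix.mul_one, Matrix.mul_one, Matrix.mul_assoc,
    Matrix.mul_assoc, Matrix.mul_neg, ← Matrix.mul_assoc S⁻¹ M, hSM, Matrix.mul_assoc C, ← hR,
    eval_diagFirst_mul_eq hf, Matrix.neg_mul, Matrix.mul_assoc C, ← hW,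
    ← hf 1 _ W _ Matrix.det_one hQ, Matrix.one_mul, Matrix.one_mul, Matrix.neg_mul,
    Matrix.mul_assoc C, ← Matrix.mul_assoc W, Matrix.mul_nonsing_inv W hWu, Matrix.one_mul]

/-- Generically, an invariant is a polynomial in the `fPoly K n k` divided by a power of
`det X`. -/
theorem exists_mul_pow_eq_aeval
    (hf : ∀ P Q A B : Matrix (Fin (m + 1)) (Fin (m + 1)) K, P.det = 1 → Q.det = 1 →
      eval (pairPoint (P * A * Q) (P * B * Q)) f = eval (pairPoint A B) f) :
    ∃ (N : ℕ) (p : MvPolynomial (Fin (m + 2)) K), f * fPoly K (m + 1) (m + 1) ^ N =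
      aeval (fun k : Fin (m + 2) => fPoly K (m + 1) k) p := by
  let x : MvPolynomial (Fin (m + 2)) K := X (Fin.last (m + 1))
  let G₁ : Matrix (Fin (m + 1)) (Fin (m + 1)) (MvPolynomial (Fin (m + 2)) K) := x • diagFirst x
  let G₂ : Matrix (Fin (m + 1)) (Fin (m + 1)) (MvPolynomial (Fin (m + 2)) K) :=
    -(companionLike x (fun i => X i.castSucc) * diagFirst x)
  obtain ⟨N, p, hp⟩ := exists_clear_denominators (pairPoint G₁ G₂) x f
  refine ⟨N, p, ?_⟩
  let XX : Matrix (Fin (m + 1)) (Fin (m + 1))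
    (MvPolynomial (Fin (m + 1) × Fin (m + 1) × Fin 2) K) := Matrix.of fun i j => X (i, j, 0)
  let YY : Matrix (Fin (m + 1)) (Fin (m + 1))
    (MvPolynomial (Fin (m + 1) × Fin (m + 1) × Fin 2) K) := Matrix.of fun i j => X (i, j, 1)
  let Δ := (krylovMatrix (-(YY * XX.adjugate))).det * XX.det
  have hXX (A B : Matrix (Fin (m + 1)) (Fin (m + 1)) K) :
      XX.map (eval (pairPoint A B)) = A := by
    ext i j
    simp [XX, pairPoint]
  have hYY (A B : Matrix (Fin (m + 1)) (Fin (m + 1)) K) :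
      YY.map (eval (pairPoint A B)) = B := by
    ext i j
    simp [YY, pairPoint]
  have hΔ (A B : Matrix (Fin (m + 1)) (Fin (m + 1)) K) :
      eval (pairPoint A B) Δ = (krylovMatrix (-(B * A.adjugate))).det * A.det := by
    have h : (-(YY * XX.adjugate)).map (eval (pairPoint A B)) = -(B * A.adjugate) := by
      rw [← RingHom.mapMatrix_apply, map_neg, map_mul, RingHom.map_adjugate,
        RingHom.mapMatrix_apply, RingHom.mapMatrix_apply, hXX, hYY]
    rw [map_mul, RingHom.map_det, RingHom.map_det, RingHom.mapMatrix_apply,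
      RingHom.mapMatrix_apply, map_krylovMatrix, h, hXX]
  have hΔ0 : Δ ≠ 0 := by
    intro h
    have := hΔ 1 (-companionLike 1 0)
    rw [h, map_zero, Matrix.adjugate_one, Matrix.mul_one, neg_neg,
      krylovMatrix_companionLike_zero, Matrix.det_one, mul_one] at this
    exact zero_ne_one this
  refine mul_right_cancel₀ hΔ0 (MvPolynomial.funext fun v => ?_)
  obtain ⟨A, B, rfl⟩ := exists_eq_pairPoint v
  rw [map_mul, map_mul (eval (pairPoint A B)) _ Δ]
  by_cases hAB : eval (pairPoint A B) Δ = 0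
  · rw [hAB, mul_zero, mul_zero]
  congr 1
  rw [hΔ] at hAB
  have hA : A.det ≠ 0 := right_ne_zero_of_mul hAB
  set M := -(B * A⁻¹) with hMdef
  have hB : B = -(M * A) := by
    rw [hMdef, Matrix.neg_mul, neg_neg, Matrix.mul_assoc, Matrix.nonsing_inv_mul A hA.isUnit,
      Matrix.mul_one]
  have hM : (krylovMatrix M).det ≠ 0 := by
    have hadj : -(B * A.adjugate) = A.det • M := by
      rw [hMdef, Matrix.inv_def, Ring.inverse_eq_inv', Matrix.mul_smul, smul_neg, smul_smul,
        mul_inv_cancel₀ hA, one_smul]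
    have h := left_ne_zero_of_mul hAB
    rw [hadj, krylovMatrix_smul, Matrix.det_mul] at h
    exact left_ne_zero_of_mul h
  have hmixed (k : ℕ) : mixedDet k A B = M.charpoly.coeff k * A.det := by
    conv_lhs => rw [hB]
    exact mixedDet_neg_mul k M A
  let z : Fin (m + 2) → K := fun k => mixedDet k A B
  have hx : eval z x = A.det := by
    simp [x, z, mixedDet_self]
  have hG : (fun v => eval z (pairPoint G₁ G₂ v) / eval z x) = pairPoint (diagFirst A.det)
      (-(companionLike 1 (fun i : Fin (m + 1) => M.charpoly.coeff i) * diagFirst A.det)) := by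
    have h₁ : G₁.map (eval z) = A.det • diagFirst A.det := by
      rw [Matrix.map_smul' (eval z) _ _ (map_mul _), map_diagFirst, hx]
    have hc : companionLike A.det (fun i : Fin (m + 1) => z i.castSucc) =
        A.det • companionLike 1 (fun i : Fin (m + 1) => M.charpoly.coeff i) := by
      ext i j
      simp only [companionLike, Matrix.of_apply, Matrix.smul_apply, z, hmixed, Fin.val_castSucc]
      split_ifs <;> simp [mul_comm]
    have h₂ : G₂.map (eval z) = A.det •
        -(companionLike 1 (fun i : Fin (m + 1) => M.charpoly.coeff i) * diagFirst A.det) := by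
      rw [← RingHom.mapMatrix_apply, map_neg, map_mul, RingHom.mapMatrix_apply,
        RingHom.mapMatrix_apply, map_companionLike, map_diagFirst, hx]
      simp only [eval_X]
      rw [hc, Matrix.smul_mul, smul_neg]
    funext v
    rw [map_pairPoint (eval z), h₁, h₂, hx, div_eq_iff hA]
    unfold pairPoint
    split_ifs <;> simp [mul_comm]
  rw [eval_aeval_fPoly, hp z (by rwa [hx]), hG, hx, map_mul, map_pow, eval_fPoly, mixedDet_self,
    mul_comm]
  congr 1
  conv_lhs => rw [hB]
  exact eval_eq_eval_normalForm hf A M hA hM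

/-- Divisions by `det X` can be undone inside the algebra generated by the `fPoly K n k`. -/
theorem exists_eq_aeval_of_mul_pow (N : ℕ) (p : MvPolynomial (Fin (m + 2)) K)
    (h : f * fPoly K (m + 1) (m + 1) ^ N = aeval (fun k : Fin (m + 2) => fPoly K (m + 1) k) p) :
    ∃ q : MvPolynomial (Fin (m + 2)) K,
      f = aeval (fun k : Fin (m + 2) => fPoly K (m + 1) k) q := by
  induction N generalizing p with
  | zero => exact ⟨p, by rwa [pow_zero, mul_one] at h⟩
  | succ N ih =>
    have hdvd : (X (Fin.last (m + 1)) : MvPolynomial (Fin (m + 2)) K) ∣ p := by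
      refine X_dvd_of_eval_eq_zero (j := 0) (Fin.last_pos.ne) p fun z hz hz0 => ?_
      obtain ⟨A, B, hAB⟩ := exists_mixedDet_eq' z hz0
      have h1 := congrArg (eval (pairPoint A B)) h
      have hlast : mixedDet (m + 1) A B = 0 := (hAB (Fin.last (m + 1))).trans hz
      rw [eval_aeval_fPoly, map_mul, map_pow, eval_fPoly, hlast, pow_succ, mul_zero,
        mul_zero] at h1
      simpa only [hAB] using h1.symm
    obtain ⟨q, rfl⟩ := hdvd
    refine ih q (mul_right_cancel₀ (b := fPoly K (m + 1) (m + 1)) ?_ ?_)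
    · intro h0
      have h1 := eval_fPoly (K := K) (m + 1) (1 : Matrix (Fin (m + 1)) (Fin (m + 1)) K) 1
      rw [h0, map_zero, mixedDet_self, Matrix.det_one] at h1
      exact zero_ne_one h1
    · rw [mul_assoc, ← pow_succ, h, map_mul, aeval_X, Fin.val_last, mul_comm]

theorem algebraicIndependent_fPoly :
    AlgebraicIndependent K fun k : Fin (m + 2) => fPoly K (m + 1) k := by
  rw [algebraicIndependent_iff]
  intro p hp
  refine (mul_eq_zero.mp (MvPolynomial.funext (p := p * X 0) (q := 0) fun z => ?_)).resolve_right
    (X_ne_zero 0)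
  rw [map_mul, eval_X, map_zero]
  by_cases hz : z 0 = 0
  · rw [hz, mul_zero]
  · obtain ⟨A, B, hAB⟩ := exists_mixedDet_eq' z hz
    have h := congrArg (eval (pairPoint A B)) hp
    rw [eval_aeval_fPoly, map_zero] at h
    simp only [hAB] at h
    rw [h, zero_mul]

end NormalForm

/-- for n ≥ 2 over an infinite field K, the ring of invariants
K[T]^{SL(n,K)×SL(n,K)} equals K[f_{n,0},...,f_{0,n}], and it is a polynomial ring
in n+1 variables over K. -/
theorem invariants_sl_sl (K : Type*) [Field K] [Infinite K] (n : ℕ) (hn : 2 ≤ n) :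
    {f : MvPolynomial (Fin n × Fin n × Fin 2) K |
        ∀ P Q : Matrix (Fin n) (Fin n) K, P.det = 1 → Q.det = 1 →
          slPairAction K n P Q f = f} =
      (Algebra.adjoin K (Set.range fun k : Fin (n + 1) => fPoly K n (k : ℕ)) :
        Subalgebra K (MvPolynomial (Fin n × Fin n × Fin 2) K)) ∧
    Nonempty
      (MvPolynomial (Fin (n + 1)) K ≃ₐ[K]
        Algebra.adjoin K (Set.range fun k : Fin (n + 1) => fPoly K n (k : ℕ))) := by
  obtain ⟨m, rfl⟩ : ∃ m, n = m + 1 := ⟨n - 1, by omega⟩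
  refine ⟨?_, ⟨(algebraicIndependent_fPoly (K := K) (m := m)).aevalEquiv⟩⟩
  ext f
  rw [Set.mem_ofPred_eq, SetLike.mem_coe, Algebra.adjoin_range_eq_range_aeval]
  constructor
  · intro hf
    have hf' (P Q A B : Matrix (Fin (m + 1)) (Fin (m + 1)) K) (hP : P.det = 1) (hQ : Q.det = 1) :
        eval (pairPoint (P * A * Q) (P * B * Q)) f = eval (pairPoint A B) f := by
      have h := eval_slPairAction P.transpose Q A B f
      rw [hf _ _ (by rwa [Matrix.det_transpose]) hQ, Matrix.transpose_transpose] at h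
      exact h.symm
    obtain ⟨N, p, hp⟩ := exists_mul_pow_eq_aeval hf'
    obtain ⟨q, hq⟩ := exists_eq_aeval_of_mul_pow N p hp
    exact ⟨q, hq.symm⟩
  · rintro ⟨p, rfl⟩ P Q hP hQ
    change slPairAction K (m + 1) P Q (aeval _ p) = aeval _ p
    rw [← AlgHom.comp_apply, comp_aeval]
    simp only [slPairAction_fPoly _ P Q hP hQ]
end

section
/- Let K be a field, m ≤ n ≤ 2m, and let X, Y be m×n matrices of independent indeterminates. Equip K[X,Y] with the degree lexicographic order T_{111} > T_{211} > ... (column-major order on X, then on Y). If f is a nonzero element of K[Γ(X,Y)] ∩ K[Γ'((X;Y))] — the intersection of the subalgebra generated by the m×m minors of the m×2n matrix (X Y) and the subalgebra generated by the n×n minors of the 2m×n matrix formed by stacking X over Y — then every variable in the leading monomial of f lies in {X_{11}, X_{22}, ..., X_{mm}} ∪ {Y_{1,n-m+1}, Y_{2,n-m+2}, ..., Y_{m,n}}. -/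
open MvPolynomial

/-- Significance key of the variable T_{ijk} (i ∈ Fin m rows, j ∈ Fin n columns,
k ∈ Fin 2): the variables are ordered T_{111} > T_{211} > ... > T_{m11} > T_{121} >
... > T_{mn1} > T_{112} > ... > T_{mn2}; smaller key = larger variable. -/
def varKeyR (m n : ℕ) (v : Fin m × Fin n × Fin 2) : ℕ :=
  (v.2.2 : ℕ) * (m * n) + (v.2.1 : ℕ) * m + (v.1 : ℕ)

/-- Degree-lexicographic strict order on monomials (exponent vectors). -/
def monLTR (m n : ℕ) (a b : (Fin m × Fin n × Fin 2) →₀ ℕ) : Prop :=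
  (a.sum fun _ e => e) < (b.sum fun _ e => e) ∨
    ((a.sum fun _ e => e) = (b.sum fun _ e => e) ∧
      ∃ v, (∀ w, varKeyR m n w < varKeyR m n v → a w = b w) ∧ a v < b v)

/-- `μ` is the leading monomial of `f` w.r.t. the degree-lexicographic order. -/
def IsLeadMonR {K : Type*} [CommRing K] (m n : ℕ)
    (f : MvPolynomial (Fin m × Fin n × Fin 2) K) (μ : (Fin m × Fin n × Fin 2) →₀ ℕ) : Prop :=
  μ ∈ f.support ∧ ∀ ν ∈ f.support, ν ≠ μ → monLTR m n ν μ

section Shear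

variable {σ K : Type*} [Fintype σ] [DecidableEq σ] [CommRing K]

/-- The substitution `X v ↦ X v + t * X (g v)` for the variables `v` satisfying `P`. -/
noncomputable def shearHom (P : σ → Prop) [DecidablePred P] (g : σ → σ) :
    MvPolynomial σ K →ₐ[K] Polynomial (MvPolynomial σ K) :=
  aeval fun v => (if P v then Polynomial.X * Polynomial.C (X (g v)) else 0) + Polynomial.C (X v)

/-- The exponent vector obtained from `ν` by replacing, for each `v`, `κ v` copies of the
variable `v` by `g v`. -/
noncomputable def shearExp (g : σ → σ) (ν κ : σ → ℕ) : σ →₀ ℕ :=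
  ∑ v, (Finsupp.single v (ν v - κ v) + Finsupp.single (g v) (κ v))

omit [Fintype σ] [DecidableEq σ] in
theorem prod_monomial_monomial (s : Finset σ) (κ : σ → ℕ) (d : σ → σ →₀ ℕ) (c : σ → K) :
    ∏ v ∈ s, Polynomial.monomial (κ v) (monomial (d v) (c v)) =
      Polynomial.monomial (∑ v ∈ s, κ v) (monomial (∑ v ∈ s, d v) (∏ v ∈ s, c v)) := by
  classical
  induction s using Finset.induction_on with
  | empty => simp
  | insert a s ha ih =>
    rw [Finset.prod_insert ha, Finset.sum_insert ha, Finset.sum_insert ha, Finset.prod_insert ha,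
      ih, Polynomial.monomial_mul_monomial, monomial_mul]

omit [Fintype σ] [DecidableEq σ] in
theorem shearHom_X (P : σ → Prop) [DecidablePred P] (g : σ → σ) (v : σ) :
    shearHom P g (X v : MvPolynomial σ K) =
      (if P v then Polynomial.X * Polynomial.C (X (g v)) else 0) + Polynomial.C (X v) :=
  aeval_X _ _

theorem shearHom_monomial (P : σ → Prop) [DecidablePred P] (g : σ → σ) (ν : σ →₀ ℕ) (a : K) :
    shearHom P g (monomial ν a) =
      ∑ κ ∈ Fintype.piFinset fun v => Finset.range (ν v + 1),
        if ∀ v, ¬ P v → κ v = 0 then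
          Polynomial.monomial (∑ v, κ v)
            (monomial (shearExp g ν κ) (a * ∏ v, ((ν v).choose (κ v) : K)))
        else 0 := by
  rw [shearHom, aeval_monomial, Finsupp.prod_fintype _ _ (fun _ => pow_zero _)]
  simp_rw [add_pow]
  rw [Finset.prod_univ_sum, Finset.mul_sum]
  refine Finset.sum_congr rfl fun κ _ => ?_
  split_ifs with h
  · have key : ∀ v, (if P v then Polynomial.X * Polynomial.C (X (g v)) else 0) ^ κ v *
        Polynomial.C (X v) ^ (ν v - κ v) * ((ν v).choose (κ v) : Polynomial (MvPolynomial σ K)) =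
        Polynomial.monomial (κ v) (monomial (Finsupp.single v (ν v - κ v) +
          Finsupp.single (g v) (κ v)) ((ν v).choose (κ v) : K)) := by
      intro v
      have h1 : (if P v then Polynomial.X * Polynomial.C (X (g v)) else 0 :
          Polynomial (MvPolynomial σ K)) ^ κ v =
          (Polynomial.X * Polynomial.C (X (g v))) ^ κ v := by
        by_cases hv : P v
        · rw [if_pos hv]
        · rw [h v hv, pow_zero, pow_zero]
      have h2 : (monomial (Finsupp.single v (ν v - κ v) + Finsupp.single (g v) (κ v)))
          ((ν v).choose (κ v) : K) =
          X (g v) ^ κ v * X v ^ (ν v - κ v) * ((ν v).choose (κ v) : MvPolynomial σ K) := by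
        rw [X_pow_eq_monomial, X_pow_eq_monomial, monomial_mul, ← map_natCast (C (σ := σ)) _,
          mul_comm, C_mul_monomial, add_comm]
        simp
      rw [h1, h2, ← Polynomial.C_mul_X_pow_eq_monomial]
      simp only [map_mul, map_pow, map_natCast, mul_pow]
      ring
    rw [Finset.prod_congr rfl fun v _ => key v, prod_monomial_monomial]
    rw [Polynomial.algebraMap_apply, MvPolynomial.algebraMap_eq, Polynomial.C_mul_monomial,
      C_mul_monomial, shearExp]
  · push Not at h
    obtain ⟨v, hv, hκ⟩ := h
    rw [Finset.prod_eq_zero (Finset.mem_univ v), mul_zero]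
    rw [if_neg hv, zero_pow hκ, zero_mul, zero_mul]

theorem exists_shearExp_eq {P : σ → Prop} [DecidablePred P] {g : σ → σ} {f : MvPolynomial σ K}
    (hf : shearHom P g f = Polynomial.C f) {μ : σ →₀ ℕ} (hμ : μ ∈ f.support) {v₀ : σ}
    (hP : P v₀) (hv₀ : μ v₀ ≠ 0) :
    ∃ ν ∈ f.support, ∃ κ : σ → ℕ, (∀ v, κ v ≤ ν v) ∧ (∀ v, ¬ P v → κ v = 0) ∧
      ∑ v, κ v = μ v₀ ∧ shearExp g ν κ = shearExp g μ (Pi.single v₀ (μ v₀)) ∧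
      (κ = Pi.single v₀ (μ v₀) → ν ≠ μ) := by
  by_contra! hcon
  have h0 := congrArg
    (fun p => coeff (shearExp g μ (Pi.single v₀ (μ v₀))) (Polynomial.coeff p (μ v₀))) hf
  simp only [Polynomial.coeff_C, if_neg hv₀, coeff_zero] at h0
  rw [← support_sum_monomial_coeff f, map_sum] at h0
  simp_rw [shearHom_monomial, Polynomial.finsetSum_coeff, coeff_sum] at h0
  refine mem_support_iff.1 hμ (Eq.trans ?_ h0)
  rw [Finset.sum_eq_single_of_mem μ hμ, Finset.sum_eq_single_of_mem (Pi.single v₀ (μ v₀))]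
  · rw [if_pos]
    · rw [Polynomial.coeff_monomial, if_pos (by simp), coeff_monomial, if_pos rfl,
        Finset.prod_eq_one, mul_one]
      intro v _
      by_cases hv : v = v₀
      · subst hv; simp
      · simp [hv]
    · intro v hv
      exact Pi.single_eq_of_ne (by rintro rfl; exact hv hP) _
  · rw [Fintype.mem_piFinset]
    intro v
    by_cases hv : v = v₀
    · subst hv; simp
    · simp [hv]
  · intro κ hκ hne
    split_ifs with h
    · rw [Polynomial.coeff_monomial]
      split_ifs with h1
      · rw [coeff_monomial, if_neg]
        intro h2
        exact hne (hcon μ hμ κ (fun v => Nat.lt_succ_iff.1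
          (Finset.mem_range.1 (Fintype.mem_piFinset.1 hκ v))) h h1 h2).1
      · simp
    · simp
  · intro ν hν hne
    refine Finset.sum_eq_zero fun κ hκ => ?_
    split_ifs with h
    · rw [Polynomial.coeff_monomial]
      split_ifs with h1
      · rw [coeff_monomial, if_neg]
        intro h2
        exact hne (hcon ν hν κ (fun v => Nat.lt_succ_iff.1
          (Finset.mem_range.1 (Fintype.mem_piFinset.1 hκ v))) h h1 h2).2
      · simp
    · simp

theorem shearExp_apply (g : σ → σ) (ν κ : σ → ℕ) (u : σ) :
    shearExp g ν κ u = (ν u - κ u) + ∑ v, if g v = u then κ v else 0 := by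
  simp only [shearExp, Finsupp.finsetSum_apply, Finsupp.add_apply, Finset.sum_add_distrib,
    Finsupp.single_apply, Finset.sum_ite_eq', Finset.mem_univ, if_true]

omit [DecidableEq σ] in
theorem degree_shearExp (g : σ → σ) {ν κ : σ → ℕ} (h : ∀ v, κ v ≤ ν v) :
    (shearExp g ν κ).degree = ∑ v, ν v := by
  rw [shearExp, map_sum]
  refine Finset.sum_congr rfl fun v _ => ?_
  rw [map_add, Finsupp.degree_single, Finsupp.degree_single, Nat.sub_add_cancel (h v)]

theorem exists_mem_support_shear {P : σ → Prop} [DecidablePred P] {g : σ → σ}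
    (hgP : ∀ v, P v → ¬ P (g v)) (hinj : ∀ v w, P v → P w → g v = g w → v = w)
    {f : MvPolynomial σ K} (hf : shearHom P g f = Polynomial.C f)
    {μ : σ →₀ ℕ} (hμ : μ ∈ f.support) {v₀ : σ} (hP : P v₀) (hv₀ : μ v₀ ≠ 0) :
    ∃ ν ∈ f.support, ∃ κ : σ → ℕ, ν.degree = μ.degree ∧ κ v₀ < μ v₀ ∧
      (∃ c, P c ∧ c ≠ v₀ ∧ κ c ≠ 0) ∧ ν v₀ = κ v₀ ∧
      (∀ v, P v → v ≠ v₀ → ν v = μ v + κ v) ∧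
      ν (g v₀) + κ v₀ = μ (g v₀) + μ v₀ ∧
      (∀ v, P v → v ≠ v₀ → ν (g v) + κ v = μ (g v)) ∧
      ∀ u, ¬ P u → (∀ v, P v → g v ≠ u) → ν u = μ u := by
  obtain ⟨ν, hν, κ, hle, hκP, hsum, hexp, hne⟩ := exists_shearExp_eq hf hμ hP hv₀
  set κ₀ : σ → ℕ := Pi.single v₀ (μ v₀) with hκ₀
  have hκ₀v₀ : κ₀ v₀ = μ v₀ := Pi.single_eq_same _ _
  have hκ₀ne : ∀ v, v ≠ v₀ → κ₀ v = 0 := fun v hv => Pi.single_eq_of_ne hv _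
  have hκ₀P : ∀ v, ¬ P v → κ₀ v = 0 := fun v hv => hκ₀ne v (by rintro rfl; exact hv hP)
  have hκ₀le : ∀ v, κ₀ v ≤ μ v := by
    intro v
    by_cases hv : v = v₀
    · rw [hv, hκ₀v₀]
    · rw [hκ₀ne v hv]; exact Nat.zero_le _
  have hpt : ∀ u, (ν u - κ u) + (∑ v, if g v = u then κ v else 0) =
      (μ u - κ₀ u) + ∑ v, if g v = u then κ₀ v else 0 := by
    intro u
    rw [← shearExp_apply, ← shearExp_apply, hexp]
  have sum_off : ∀ (τ : σ → ℕ), (∀ v, ¬ P v → τ v = 0) → ∀ u, (∀ v, P v → g v ≠ u) →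
      (∑ v, if g v = u then τ v else 0) = 0 := by
    intro τ hτ u hu
    refine Finset.sum_eq_zero fun v _ => ?_
    by_cases hv : P v
    · rw [if_neg (hu v hv)]
    · rw [hτ v hv, ite_self]
  have sum_on : ∀ (τ : σ → ℕ), (∀ v, ¬ P v → τ v = 0) → ∀ u, P u →
      (∑ v, if g v = g u then τ v else 0) = τ u := by
    intro τ hτ u hu
    rw [Finset.sum_eq_single_of_mem u (Finset.mem_univ u), if_pos rfl]
    intro v _ hvu
    by_cases hv : P v
    · rw [if_neg fun h => hvu (hinj v u hv hu h)]
    · rw [hτ v hv, ite_self]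
  have hon : ∀ v, P v → ν v - κ v = μ v - κ₀ v := by
    intro v hv
    have h := hpt v
    rwa [sum_off κ hκP v fun w hw h => hgP w hw (h ▸ hv),
      sum_off κ₀ hκ₀P v fun w hw h => hgP w hw (h ▸ hv)] at h
  have htarget : ∀ v, P v → ν (g v) + κ v = μ (g v) + κ₀ v := by
    intro v hv
    have h := hpt (g v)
    rwa [sum_on κ hκP v hv, sum_on κ₀ hκ₀P v hv, hκP _ (hgP v hv), hκ₀P _ (hgP v hv)] at h
  have hrest : ∀ u, ¬ P u → (∀ v, P v → g v ≠ u) → ν u = μ u := by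
    intro u hu hgu
    have h := hpt u
    rwa [sum_off κ hκP u hgu, sum_off κ₀ hκ₀P u hgu, hκP u hu, hκ₀P u hu] at h
  have hκne : κ ≠ κ₀ := by
    intro h
    refine hne h (Finsupp.ext fun u => ?_)
    have h1 := hpt u
    have h2 := hle u
    have h3 := hκ₀le u
    rw [h] at h1 h2
    omega
  have hex : ∃ c, P c ∧ c ≠ v₀ ∧ κ c ≠ 0 := by
    by_contra! hall
    have hz : ∀ v, v ≠ v₀ → κ v = 0 := fun v hv =>
      if hPv : P v then hall v hPv hv else hκP v hPv
    have hs : κ v₀ = μ v₀ := by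
      rw [← hsum, Finset.sum_eq_single_of_mem v₀ (Finset.mem_univ _) fun v _ hv => hz v hv]
    refine hκne (funext fun v => ?_)
    by_cases hv : v = v₀
    · rw [hv, hκ₀v₀, hs]
    · rw [hz v hv, hκ₀ne v hv]
  refine ⟨ν, hν, κ, ?_, ?_, hex, ?_, ?_, ?_, ?_, hrest⟩
  · have h := congrArg Finsupp.degree hexp
    rwa [degree_shearExp g hle, degree_shearExp g hκ₀le, ← Finsupp.degree_eq_sum,
      ← Finsupp.degree_eq_sum] at h
  · obtain ⟨c, -, hc, hκc⟩ := hex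
    have h := Finset.add_le_sum (s := Finset.univ) (f := κ) (fun _ _ => Nat.zero_le _)
      (Finset.mem_univ v₀) (Finset.mem_univ c) hc.symm
    omega
  · have h := hon v₀ hP
    have h' := hle v₀
    omega
  · intro v hv hvne
    have h := hon v hv
    have h' := hle v
    rw [hκ₀ne v hvne] at h
    omega
  · rw [htarget v₀ hP, hκ₀v₀]
  · intro v hv hvne
    rw [htarget v hv, hκ₀ne v hvne, add_zero]

/-- A shear whose target precedes the source at `v₀` and, where the targets occur in `μ`, is most
significant at `v₀`, forces `v₀` not to occur in the leading exponent `μ`. -/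
theorem lead_eq_zero_of_target_lt {P : σ → Prop} [DecidablePred P] {g : σ → σ}
    (hgP : ∀ v, P v → ¬ P (g v)) (hinj : ∀ v w, P v → P w → g v = g w → v = w)
    {f : MvPolynomial σ K} (hf : shearHom P g f = Polynomial.C f)
    {μ : σ →₀ ℕ} (hμ : μ ∈ f.support) {key : σ → ℕ}
    (hlead : ∀ ν ∈ f.support, ν ≠ μ → ν.degree = μ.degree →
      ∃ w, (∀ u, key u < key w → ν u = μ u) ∧ ν w < μ w)
    {v₀ : σ} (hP : P v₀) (hlt : key (g v₀) < key v₀)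
    (hother : ∀ v, P v → v ≠ v₀ → μ (g v) = 0 ∨ key (g v₀) < key (g v)) : μ v₀ = 0 := by
  by_contra hv₀
  obtain ⟨ν, hν, κ, hdeg, hκ, -, h1, h2, h3, h4, h5⟩ :=
    exists_mem_support_shear hgP hinj hf hμ hP hv₀
  obtain ⟨w, hw, hlt'⟩ := hlead ν hν (by rintro rfl; omega) hdeg
  have hnot : ¬ key (g v₀) < key w := fun h => by
    have := hw _ h
    omega
  by_cases hPw : P w
  · by_cases hwv : w = v₀
    · exact hnot (hwv ▸ hlt)
    · have := h2 w hPw hwv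
      omega
  · by_cases hex : ∃ v, P v ∧ g v = w
    · obtain ⟨v, hv, rfl⟩ := hex
      by_cases hvv : v = v₀
      · subst hvv
        omega
      · rcases hother v hv hvv with h | h
        · omega
        · exact hnot h
    · push Not at hex
      have := h5 w hPw hex
      omega

/-- A shear whose sources precede their targets and, where the targets occur in `μ`, is least
significant at `v₀`, forces `v₀` not to occur in the leading exponent `μ`. -/
theorem lead_eq_zero_of_source_lt {P : σ → Prop} [DecidablePred P] {g : σ → σ}
    (hgP : ∀ v, P v → ¬ P (g v)) (hinj : ∀ v w, P v → P w → g v = g w → v = w)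
    {f : MvPolynomial σ K} (hf : shearHom P g f = Polynomial.C f)
    {μ : σ →₀ ℕ} (hμ : μ ∈ f.support) {key : σ → ℕ}
    (hlead : ∀ ν ∈ f.support, ν ≠ μ → ν.degree = μ.degree →
      ∃ w, (∀ u, key u < key w → ν u = μ u) ∧ ν w < μ w)
    {v₀ : σ} (hP : P v₀) (hlt : ∀ v, P v → key v < key (g v))
    (hother : ∀ v, P v → v ≠ v₀ → μ (g v) = 0 ∨ key v < key v₀) : μ v₀ = 0 := by
  by_contra hv₀
  obtain ⟨ν, hν, κ, hdeg, hκ, ⟨c, hPc, hc, hκc⟩, h1, h2, h3, h4, h5⟩ :=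
    exists_mem_support_shear hgP hinj hf hμ hP hv₀
  obtain ⟨w, hw, hlt'⟩ := hlead ν hν (by rintro rfl; omega) hdeg
  by_cases hPw : P w
  · by_cases hwv : w = v₀
    · subst hwv
      have hc4 := h4 c hPc hc
      have hc2 := h2 c hPc hc
      rcases hother c hPc hc with h | h
      · omega
      · have := hw c h
        omega
    · have := h2 w hPw hwv
      omega
  · by_cases hex : ∃ v, P v ∧ g v = w
    · obtain ⟨v, hv, rfl⟩ := hex
      have hwv := hw v (hlt v hv)
      by_cases hvv : v = v₀
      · subst hvv
        omega
      · have := h2 v hv hvv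
        have := h4 v hv hvv
        omega
    · push Not at hex
      have := h5 w hPw hex
      omega

end Shear

theorem varKeyR_lt {m n : ℕ} {v w : Fin m × Fin n × Fin 2}
    (h : v.2.2 < w.2.2 ∨ v.2.2 = w.2.2 ∧ (v.2.1 < w.2.1 ∨ v.2.1 = w.2.1 ∧ v.1 < w.1)) :
    varKeyR m n v < varKeyR m n w := by
  obtain ⟨i, j, k⟩ := v
  obtain ⟨i', j', k'⟩ := w
  have hi := i.isLt
  have hj := j.isLt
  simp only [varKeyR, Fin.lt_def, Fin.ext_iff] at h ⊢
  rcases h with h | ⟨h, h' | ⟨h', h''⟩⟩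
  · have h1 : ((k : ℕ) + 1) * (m * n) ≤ k' * (m * n) := Nat.mul_le_mul_right _ h
    have h2 : ((j : ℕ) + 1) * m ≤ n * m := Nat.mul_le_mul_right _ hj
    nlinarith [Nat.zero_le ((j' : ℕ) * m)]
  · have h2 : ((j : ℕ) + 1) * m ≤ j' * m := Nat.mul_le_mul_right _ h'
    rw [h]
    nlinarith
  · rw [h, h']
    omega

theorem varKeyR_lt_of_row_lt {m n : ℕ} {i i' : Fin m} {j : Fin n} {k : Fin 2}
    (h : (i : ℕ) < i') : varKeyR m n (i, j, k) < varKeyR m n (i', j, k) :=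
  varKeyR_lt (Or.inr ⟨rfl, Or.inr ⟨rfl, h⟩⟩)

theorem varKeyR_lt_of_col_lt {m n : ℕ} {i i' : Fin m} {j j' : Fin n} {k : Fin 2}
    (h : (j : ℕ) < j') : varKeyR m n (i, j, k) < varKeyR m n (i', j', k) :=
  varKeyR_lt (Or.inr ⟨rfl, Or.inl h⟩)

theorem IsLeadMonR.exists_lt {K : Type*} [CommRing K] {m n : ℕ}
    {f : MvPolynomial (Fin m × Fin n × Fin 2) K} {μ : (Fin m × Fin n × Fin 2) →₀ ℕ}
    (hμ : IsLeadMonR m n f μ) :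
    ∀ ν ∈ f.support, ν ≠ μ → ν.degree = μ.degree →
      ∃ w, (∀ u, varKeyR m n u < varKeyR m n w → ν u = μ u) ∧ ν w < μ w := by
  intro ν hν hne hdeg
  rcases hμ.2 ν hν hne with h | ⟨-, h⟩
  · exact absurd hdeg (ne_of_lt h)
  · exact h

theorem shearHom_eq_C_of_mem_adjoin {σ K : Type*} [CommRing K] (P : σ → Prop) [DecidablePred P]
    (g : σ → σ) {S : Set (MvPolynomial σ K)} (hS : ∀ p ∈ S, shearHom P g p = Polynomial.C p)
    {f : MvPolynomial σ K} (hf : f ∈ Algebra.adjoin K S) : shearHom P g f = Polynomial.C f :=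
  AlgHom.adjoin_le_equalizer (shearHom P g) Polynomial.CAlgHom hS hf

/-- Row shears fix the maximal minors of `(X Y)`. -/
theorem shearHom_rowMinor {K : Type*} [CommRing K] {m n : ℕ} {i i' : Fin m} (h : i ≠ i')
    (a : Fin m → Fin n ⊕ Fin n) :
    let p : MvPolynomial (Fin m × Fin n × Fin 2) K :=
      (Matrix.of fun i j : Fin m => Sum.elim
        (fun jj => MvPolynomial.X (i, jj, (0 : Fin 2)))
        (fun jj => MvPolynomial.X (i, jj, (1 : Fin 2))) (a j)).det
    shearHom (fun v => v.1 = i) (fun v => (i', v.2)) p = Polynomial.C p := by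
  intro p
  rw [AlgHom.map_det, RingHom.map_det]
  refine Eq.trans ?_ (Matrix.det_updateRow_add_smul_self _ h Polynomial.X)
  congr 1
  ext1 r c
  by_cases hr : r = i
  · subst hr
    rw [Matrix.updateRow_self]
    rcases hc : a c with jj | jj <;>
      simp only [AlgHom.mapMatrix_apply, RingHom.mapMatrix_apply, Matrix.map_apply,
        Matrix.of_apply, hc, Sum.elim_inl, Sum.elim_inr, Pi.add_apply, Pi.smul_apply,
        smul_eq_mul, shearHom_X, if_true, add_comm]
  · rw [Matrix.updateRow_ne hr]
    rcases hc : a c with jj | jj <;>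
      simp only [AlgHom.mapMatrix_apply, RingHom.mapMatrix_apply, Matrix.map_apply,
        Matrix.of_apply, hc, Sum.elim_inl, Sum.elim_inr, shearHom_X, if_neg hr, zero_add]

/-- Column shears fix the maximal minors of `(X; Y)`. -/
theorem shearHom_colMinor {K : Type*} [CommRing K] {m n : ℕ} {j j' : Fin n} (h : j ≠ j')
    (b : Fin n → Fin m ⊕ Fin m) :
    let p : MvPolynomial (Fin m × Fin n × Fin 2) K :=
      (Matrix.of fun i j : Fin n => Sum.elim
        (fun ii => MvPolynomial.X (ii, j, (0 : Fin 2)))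
        (fun ii => MvPolynomial.X (ii, j, (1 : Fin 2))) (b i)).det
    shearHom (fun v => v.2.1 = j) (fun v => (v.1, j', v.2.2)) p = Polynomial.C p := by
  intro p
  rw [AlgHom.map_det, RingHom.map_det]
  refine Eq.trans ?_ (Matrix.det_updateCol_add_smul_self _ h Polynomial.X)
  congr 1
  ext1 r c
  by_cases hc : c = j
  · subst hc
    rw [Matrix.updateCol_self]
    rcases hr : b r with ii | ii <;>
      simp only [AlgHom.mapMatrix_apply, RingHom.mapMatrix_apply, Matrix.map_apply,
        Matrix.of_apply, hr, Sum.elim_inl, Sum.elim_inr, smul_eq_mul, shearHom_X, if_true,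
        add_comm]
  · rw [Matrix.updateCol_ne hc]
    rcases hr : b r with ii | ii <;>
      simp only [AlgHom.mapMatrix_apply, RingHom.mapMatrix_apply, Matrix.map_apply,
        Matrix.of_apply, hr, Sum.elim_inl, Sum.elim_inr, shearHom_X, if_neg hc, zero_add]

theorem row_shear_injective {m n : ℕ} (i i' : Fin m) (v w : Fin m × Fin n × Fin 2)
    (hv : v.1 = i) (hw : w.1 = i) (h : (i', v.2) = (i', w.2)) : v = w :=
  Prod.ext (hv.trans hw.symm) (Prod.ext_iff.1 h).2

theorem col_shear_injective {m n : ℕ} (j j' : Fin n) (v w : Fin m × Fin n × Fin 2)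
    (hv : v.2.1 = j) (hw : w.2.1 = j) (h : (v.1, j', v.2.2) = (w.1, j', w.2.2)) : v = w :=
  Prod.ext (Prod.ext_iff.1 h).1
    (Prod.ext (hv.trans hw.symm) (Prod.ext_iff.1 (Prod.ext_iff.1 h).2).2)

section LeadExponent

variable {K : Type*} [CommRing K] {m n : ℕ} {f : MvPolynomial (Fin m × Fin n × Fin 2) K}
  {μ : (Fin m × Fin n × Fin 2) →₀ ℕ}

theorem IsLeadMonR.X_eq_zero_of_col_lt_row (hμ : IsLeadMonR m n f μ)
    (hrow : ∀ i i' : Fin m, i ≠ i' →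
      shearHom (fun v => v.1 = i) (fun v => (i', v.2)) f = Polynomial.C f) :
    ∀ (d : ℕ) (i : Fin m) (j : Fin n), (j : ℕ) = d → (j : ℕ) < i → μ (i, j, 0) = 0 := by
  intro d
  induction d using Nat.strong_induction_on with
  | _ d ih =>
  intro i j hd hji
  obtain ⟨i', hi'⟩ : ∃ i' : Fin m, (i' : ℕ) = j := ⟨⟨j, by omega⟩, rfl⟩
  have hne : i ≠ i' := by rintro rfl; omega
  have hshear := hrow i i' hne
  refine lead_eq_zero_of_target_lt (σ := Fin m × Fin n × Fin 2) (fun _ _ => hne.symm)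
    (row_shear_injective i i') hshear hμ.1 hμ.exists_lt rfl
    (varKeyR_lt_of_row_lt (by omega)) ?_
  rintro ⟨r, c, k⟩ hr hv
  obtain rfl : r = i := hr
  by_cases hk : k = 0
  · subst hk
    have hcj : (c : ℕ) ≠ j := fun h => hv (by rw [Fin.ext h])
    rcases lt_or_gt_of_ne hcj with h | h
    · exact Or.inl (ih c (by omega) i' c rfl (by omega))
    · exact Or.inr (varKeyR_lt_of_col_lt (by omega))
  · exact Or.inr (varKeyR_lt (Or.inl (Fin.pos_of_ne_zero hk)))

theorem IsLeadMonR.X_eq_zero_of_row_lt_col (hμ : IsLeadMonR m n f μ) (hmn : m ≤ n)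
    (hcol : ∀ j j' : Fin n, j ≠ j' →
      shearHom (fun v => v.2.1 = j) (fun v => (v.1, j', v.2.2)) f = Polynomial.C f) :
    ∀ (d : ℕ) (i : Fin m) (j : Fin n), (i : ℕ) = d → (i : ℕ) < j → μ (i, j, 0) = 0 := by
  intro d
  induction d using Nat.strong_induction_on with
  | _ d ih =>
  intro i j hd hij
  obtain ⟨j', hj'⟩ : ∃ j' : Fin n, (j' : ℕ) = i := ⟨⟨i, by omega⟩, rfl⟩
  have hne : j ≠ j' := by rintro rfl; omega
  have hshear := hcol j j' hne
  refine lead_eq_zero_of_target_lt (σ := Fin m × Fin n × Fin 2) (fun _ _ => hne.symm)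
    (col_shear_injective j j') hshear hμ.1 hμ.exists_lt rfl
    (varKeyR_lt_of_col_lt (by omega)) ?_
  rintro ⟨r, c, k⟩ hc hv
  obtain rfl : c = j := hc
  by_cases hk : k = 0
  · subst hk
    have hri : (r : ℕ) ≠ i := fun h => hv (by rw [Fin.ext h])
    rcases lt_or_gt_of_ne hri with h | h
    · exact Or.inl (ih r (by omega) r j' rfl (by omega))
    · exact Or.inr (varKeyR_lt_of_row_lt (by omega))
  · exact Or.inr (varKeyR_lt (Or.inl (Fin.pos_of_ne_zero hk)))

theorem IsLeadMonR.Y_eq_zero_of_row_lt_col (hμ : IsLeadMonR m n f μ) (hmn : m ≤ n)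
    (hrow : ∀ i i' : Fin m, i ≠ i' →
      shearHom (fun v => v.1 = i) (fun v => (i', v.2)) f = Polynomial.C f) :
    ∀ (d : ℕ) (i : Fin m) (j : Fin n), n - j = d → n - m + i < (j : ℕ) → μ (i, j, 1) = 0 := by
  intro d
  induction d using Nat.strong_induction_on with
  | _ d ih =>
  intro i j hd hij
  obtain ⟨i', hi'⟩ : ∃ i' : Fin m, n - m + (i' : ℕ) = j :=
    ⟨⟨j - (n - m), by omega⟩, by simp only; omega⟩
  have hne : i ≠ i' := by rintro rfl; omega
  have hshear := hrow i i' hne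
  refine lead_eq_zero_of_source_lt (σ := Fin m × Fin n × Fin 2) (fun _ _ => hne.symm)
    (row_shear_injective i i') hshear hμ.1 hμ.exists_lt rfl ?_ ?_
  · rintro ⟨r, c, k⟩ hr
    obtain rfl : r = i := hr
    exact varKeyR_lt_of_row_lt (by omega)
  · rintro ⟨r, c, k⟩ hr hv
    obtain rfl : r = i := hr
    by_cases hk : k = 1
    · subst hk
      have hcj : (c : ℕ) ≠ j := fun h => hv (by rw [Fin.ext h])
      rcases lt_or_gt_of_ne hcj with h | h
      · exact Or.inr (varKeyR_lt_of_col_lt (by omega))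
      · exact Or.inl (ih (n - c) (by omega) i' c rfl (by omega))
    · exact Or.inr (varKeyR_lt (Or.inl (by simp only; omega)))

theorem IsLeadMonR.Y_eq_zero_of_col_lt_row (hμ : IsLeadMonR m n f μ) (hmn : m ≤ n)
    (hcol : ∀ j j' : Fin n, j ≠ j' →
      shearHom (fun v => v.2.1 = j) (fun v => (v.1, j', v.2.2)) f = Polynomial.C f) :
    ∀ (d : ℕ) (i : Fin m) (j : Fin n), m - i = d → (j : ℕ) < n - m + i → μ (i, j, 1) = 0 := by
  intro d
  induction d using Nat.strong_induction_on with
  | _ d ih =>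
  intro i j hd hij
  obtain ⟨j', hj'⟩ : ∃ j' : Fin n, (j' : ℕ) = n - m + i := ⟨⟨n - m + i, by omega⟩, rfl⟩
  have hne : j ≠ j' := by rintro rfl; omega
  have hshear := hcol j j' hne
  refine lead_eq_zero_of_source_lt (σ := Fin m × Fin n × Fin 2) (fun _ _ => hne.symm)
    (col_shear_injective j j') hshear hμ.1 hμ.exists_lt rfl ?_ ?_
  · rintro ⟨r, c, k⟩ hc
    obtain rfl : c = j := hc
    exact varKeyR_lt_of_col_lt (by omega)
  · rintro ⟨r, c, k⟩ hc hv
    obtain rfl : c = j := hc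
    by_cases hk : k = 1
    · subst hk
      have hri : (r : ℕ) ≠ i := fun h => hv (by rw [Fin.ext h])
      rcases lt_or_gt_of_ne hri with h | h
      · exact Or.inr (varKeyR_lt_of_row_lt (by omega))
      · exact Or.inl (ih (m - r) (by omega) r j' rfl (by omega))
    · exact Or.inr (varKeyR_lt (Or.inl (by simp only; omega)))

end LeadExponent

/-- let m ≤ n ≤ 2m and let f be a nonzero element of
K[Γ(X Y)] ∩ K[Γ'((X;Y))], the intersection of the subalgebra generated by the
m×m minors of the m×2n matrix (X Y) and the subalgebra generated by the n×n
minors of the 2m×n matrix (X;Y).  Then every variable occurring in the leading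
monomial of f lies in {X_{11},...,X_{mm}} ∪ {Y_{1,n-m+1},...,Y_{m,n}}. -/
theorem leadMon_support_of_double_invariant (K : Type*) [Field K] (m n : ℕ)
    (hm : 0 < m) (hmn : m ≤ n) (hn2m : n ≤ 2 * m)
    (f : MvPolynomial (Fin m × Fin n × Fin 2) K) (hf : f ≠ 0)
    (hfA : f ∈ Algebra.adjoin K
      {p : MvPolynomial (Fin m × Fin n × Fin 2) K |
        ∃ a : Fin m → Fin n ⊕ Fin n, Function.Injective a ∧
          p = (Matrix.of fun i j : Fin m =>
                Sum.elim
                  (fun jj => MvPolynomial.X (i, jj, (0 : Fin 2)))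
                  (fun jj => MvPolynomial.X (i, jj, (1 : Fin 2))) (a j)).det})
    (hfB : f ∈ Algebra.adjoin K
      {p : MvPolynomial (Fin m × Fin n × Fin 2) K |
        ∃ b : Fin n → Fin m ⊕ Fin m, Function.Injective b ∧
          p = (Matrix.of fun i j : Fin n =>
                Sum.elim
                  (fun ii => MvPolynomial.X (ii, j, (0 : Fin 2)))
                  (fun ii => MvPolynomial.X (ii, j, (1 : Fin 2))) (b i)).det})
    (μ : (Fin m × Fin n × Fin 2) →₀ ℕ) (hμ : IsLeadMonR m n f μ) :
    ∀ v ∈ μ.support,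
      (v.2.2 = 0 ∧ (v.1 : ℕ) = (v.2.1 : ℕ)) ∨
      (v.2.2 = 1 ∧ (v.2.1 : ℕ) = n - m + (v.1 : ℕ)) := by
  have hrow : ∀ i i' : Fin m, i ≠ i' →
      shearHom (fun v => v.1 = i) (fun v => (i', v.2)) f = Polynomial.C f := by
    intro i i' h
    refine shearHom_eq_C_of_mem_adjoin _ _ ?_ hfA
    rintro p ⟨a, -, rfl⟩
    exact shearHom_rowMinor h a
  have hcol : ∀ j j' : Fin n, j ≠ j' →
      shearHom (fun v => v.2.1 = j) (fun v => (v.1, j', v.2.2)) f = Polynomial.C f := by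
    intro j j' h
    refine shearHom_eq_C_of_mem_adjoin _ _ ?_ hfB
    rintro p ⟨b, -, rfl⟩
    exact shearHom_colMinor h b
  rintro ⟨i, j, k⟩ hv
  rw [Finsupp.mem_support_iff] at hv
  by_cases hk : k = 0
  · subst hk
    refine Or.inl ⟨rfl, ?_⟩
    rcases lt_trichotomy (i : ℕ) j with h | h | h
    · exact absurd (hμ.X_eq_zero_of_row_lt_col hmn hcol _ i j rfl h) hv
    · exact h
    · exact absurd (hμ.X_eq_zero_of_col_lt_row hrow _ i j rfl h) hv
  · obtain rfl : k = 1 := by omega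
    refine Or.inr ⟨rfl, ?_⟩
    rcases lt_trichotomy (j : ℕ) (n - m + i) with h | h | h
    · exact absurd (hμ.Y_eq_zero_of_col_lt_row hmn hcol _ i j rfl h) hv
    · exact h
    · exact absurd (hμ.Y_eq_zero_of_row_lt_col hmn hrow _ i j rfl h) hv
end
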